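/- Let p > 0, α ≤ p, and let θ be a real number with 0 ≤ θ < p/(p+1). Then for every ε > 0 there exists a constant C_ε > 0 such that Ã(t) − θ·t·ã(t) ≥ (p/(p+1) − θ − ε)·t·ã(t) − C_ε for all t ≥ 0. -/

import Mathlib

open Real Set

/-- a(t) = t^p / (log(e+t))^α. -/
noncomputable def a (p α t : ℝ) : ℝ := t ^ p / Real.log (Real.exp 1 + t) ^ α

/-- Ã(t) = ∫₀ᵗ ã(s) ds, where ã is a given function (intended as a⁻¹). -/
noncomputable def Atilde (atil : ℝ → ℝ) (t : ℝ) : ℝ := ∫ s in (0:ℝ)..t, atil s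

lemma one_le_log_exp_one_add {x : ℝ} (hx : 0 ≤ x) : 1 ≤ Real.log (Real.exp 1 + x) := by
  rw [Real.le_log_iff_exp_le (by positivity)]
  linarith

lemma a_zero {p : ℝ} (α : ℝ) (hp : 0 < p) : a p α 0 = 0 := by
  simp [a, Real.zero_rpow hp.ne']

lemma a_nonneg (p α : ℝ) {x : ℝ} (hx : 0 ≤ x) : 0 ≤ a p α x := by
  have := one_le_log_exp_one_add hx
  unfold a
  positivity

lemma continuousOn_a {p : ℝ} (α : ℝ) (hp : 0 < p) : ContinuousOn (a p α) (Ici 0) := by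
  intro x hx
  have hx : 0 ≤ x := hx
  have hlog := one_le_log_exp_one_add hx
  have h1 : ContinuousAt (fun t : ℝ => t ^ p) x :=
    Real.continuousAt_rpow_const x p (Or.inr hp.le)
  have h2 : ContinuousAt (fun t : ℝ => Real.log (Real.exp 1 + t)) x :=
    ContinuousAt.log (by fun_prop) (by positivity)
  exact (h1.div (h2.rpow_const (Or.inl (by positivity)))
    (by positivity)).continuousWithinAt

lemma hasDerivAt_a (p α : ℝ) {x : ℝ} (hx : 0 < x) :
    HasDerivAt (a p α)
      (a p α x * (p / x - α / ((Real.exp 1 + x) * Real.log (Real.exp 1 + x)))) x := by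
  have hlog := one_le_log_exp_one_add hx.le
  have hpos : 0 < Real.log (Real.exp 1 + x) := by linarith
  have hbase : 0 < Real.exp 1 + x := by positivity
  have h1 : HasDerivAt (fun t : ℝ => t ^ p) (p * x ^ (p - 1)) x :=
    Real.hasDerivAt_rpow_const (Or.inl hx.ne')
  have h2 : HasDerivAt (fun t : ℝ => Real.log (Real.exp 1 + t)) (1 / (Real.exp 1 + x)) x :=
    ((hasDerivAt_id x).const_add _).log hbase.ne'
  have h3 := h2.rpow_const (p := α) (Or.inl hpos.ne')
  refine (h1.div h3 (by positivity)).congr_deriv ?_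
  rw [Real.rpow_sub_one hx.ne', Real.rpow_sub_one hpos.ne', a]
  field_simp

lemma strictMonoOn_a_of_injOn {p α : ℝ} (hp : 0 < p) (hinj : InjOn (a p α) (Ici 0)) :
    StrictMonoOn (a p α) (Ici 0) := by
  intro x hx y hy hxy
  have hy0 : (0 : ℝ) ≤ y := hy
  refine ContinuousOn.strictMonoOn_of_injOn_Icc hy0 ?_
    ((continuousOn_a α hp).mono Icc_subset_Ici_self) (hinj.mono Icc_subset_Ici_self)
    ⟨hx, hxy.le⟩ ⟨hy, le_rfl⟩ hxy
  rw [a_zero α hp]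
  exact a_nonneg p α hy0

/-- The elasticity of `a p α` tends to `p`. -/
lemma tendsto_elasticity_a (p α : ℝ) :
    Filter.Tendsto
      (fun x : ℝ => p - α * (x / (Real.exp 1 + x)) / Real.log (Real.exp 1 + x))
      Filter.atTop (nhds p) := by
  have hlog : Filter.Tendsto (fun x : ℝ => Real.log (Real.exp 1 + x)) Filter.atTop Filter.atTop :=
    Real.tendsto_log_atTop.comp (Filter.tendsto_atTop_add_const_left _ _ Filter.tendsto_id)
  have hdecay : Filter.Tendsto
      (fun x : ℝ => α * (x / (Real.exp 1 + x)) / Real.log (Real.exp 1 + x))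
      Filter.atTop (nhds 0) := by
    refine squeeze_zero_norm' ?_ (hlog.const_div_atTop |α|)
    filter_upwards [Filter.eventually_ge_atTop 0] with x hx
    have := one_le_log_exp_one_add hx
    have hfrac : x / (Real.exp 1 + x) ≤ 1 :=
      div_le_one_of_le₀ (by linarith [Real.exp_pos 1]) (by positivity)
    have hfrac0 : 0 ≤ x / (Real.exp 1 + x) := by positivity
    rw [Real.norm_eq_abs, abs_div, abs_mul, abs_of_nonneg hfrac0,
      abs_of_pos (by linarith : 0 < Real.log (Real.exp 1 + x))]
    gcongr
    exact mul_le_of_le_one_right (abs_nonneg α) hfrac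
  simpa using hdecay.const_sub p

section Inverse

variable {p α : ℝ} {atil : ℝ → ℝ}

lemma strictMonoOn_of_invOn_a (hp : 0 < p) (hmaps : MapsTo atil (Ici 0) (Ici 0))
    (hinv : InvOn atil (a p α) (Ici 0) (Ici 0)) : StrictMonoOn atil (Ici 0) := by
  intro s hs t ht hst
  rw [← (strictMonoOn_a_of_injOn hp hinv.1.injOn).lt_iff_lt (hmaps hs) (hmaps ht),
    hinv.2 hs, hinv.2 ht]
  exact hst

lemma continuousAt_of_invOn_a (hp : 0 < p) (hmaps : MapsTo atil (Ici 0) (Ici 0))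
    (hinv : InvOn atil (a p α) (Ici 0) (Ici 0)) {t : ℝ} (ht : 0 < t) :
    ContinuousAt atil t := by
  have himage : atil '' Ici 0 = Ici 0 :=
    Subset.antisymm hmaps.image_subset fun x hx => ⟨a p α x, a_nonneg p α hx, hinv.1 hx⟩
  have hpos : 0 < atil t := by
    refine lt_of_le_of_ne (hmaps ht.le) fun h => ht.ne ?_
    rw [← hinv.2 (mem_Ici.2 ht.le), ← h, a_zero α hp]
  refine continuousAt_of_monotoneOn_of_image_mem_nhds
    (strictMonoOn_of_invOn_a hp hmaps hinv).monotoneOn (Ici_mem_nhds ht) ?_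
  rw [himage]
  exact Ici_mem_nhds hpos

lemma Atilde_nonneg (hmaps : MapsTo atil (Ici 0) (Ici 0)) {t : ℝ} (ht : 0 ≤ t) :
    0 ≤ Atilde atil t :=
  intervalIntegral.integral_nonneg ht fun _ hs => hmaps hs.1

lemma hasDerivAt_Atilde (hp : 0 < p) (hmaps : MapsTo atil (Ici 0) (Ici 0))
    (hinv : InvOn atil (a p α) (Ici 0) (Ici 0)) {t : ℝ} (ht : 0 < t) :
    HasDerivAt (Atilde atil) (atil t) t := by
  refine intervalIntegral.integral_hasDerivAt_right ?_ ?_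
    (continuousAt_of_invOn_a hp hmaps hinv ht)
  · refine ((strictMonoOn_of_invOn_a hp hmaps hinv).monotoneOn.mono ?_).intervalIntegrable
    rw [uIcc_of_le ht.le]
    exact Icc_subset_Ici_self
  · exact ContinuousAt.stronglyMeasurableAtFilter isOpen_Ioi
      (fun s hs => continuousAt_of_invOn_a hp hmaps hinv hs) t ht

lemma exists_monotoneOn_Atilde_comp_a (hp : 0 < p) (hmaps : MapsTo atil (Ici 0) (Ici 0))
    (hinv : InvOn atil (a p α) (Ici 0) (Ici 0)) {b : ℝ} (hb : b < p / (p + 1)) :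
    ∃ X : ℝ, 0 < X ∧
      MonotoneOn (fun x => Atilde atil (a p α x) - b * (a p α x * x)) (Ici X) := by
  have hlim := ((tendsto_elasticity_a p α).const_mul (1 - b)).sub_const b
  have hlim_pos : 0 < (1 - b) * p - b := by
    rw [lt_div_iff₀ (by linarith)] at hb
    linarith
  obtain ⟨X₀, hX₀⟩ := Filter.eventually_atTop.1 (hlim.eventually (lt_mem_nhds hlim_pos))
  refine ⟨max X₀ 1, by positivity, ?_⟩
  have hderiv : ∀ x ∈ Ici (max X₀ 1), HasDerivAt
      (fun x => Atilde atil (a p α x) - b * (a p α x * x))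
      (a p α x * ((1 - b) *
        (p - α * (x / (Real.exp 1 + x)) / Real.log (Real.exp 1 + x)) - b)) x := by
    intro x hx
    have hx0 : 0 < x := by linarith [le_max_right X₀ 1, mem_Ici.1 hx]
    have hlog := one_le_log_exp_one_add hx0.le
    have ha : 0 < a p α x := by
      unfold a
      positivity
    have hA := hasDerivAt_Atilde hp hmaps hinv ha
    rw [hinv.1 (mem_Ici.2 hx0.le)] at hA
    have hd := hasDerivAt_a p α hx0
    refine ((hA.comp x hd).sub ((hd.mul (hasDerivAt_id x)).const_mul b)).congr_deriv ?_
    simp only [id]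
    field_simp
    ring
  refine monotoneOn_of_deriv_nonneg (convex_Ici _)
    (fun x hx => (hderiv x hx).continuousAt.continuousWithinAt)
    (fun x hx => (hderiv x (interior_subset hx)).differentiableAt.differentiableWithinAt) ?_
  intro x hx
  have hx := mem_Ici.1 (interior_subset hx)
  rw [(hderiv x hx).deriv]
  exact mul_nonneg (a_nonneg p α (by linarith [le_max_right X₀ 1]))
    (hX₀ x ((le_max_left _ _).trans hx)).le

lemma exists_sub_le_Atilde (hp : 0 < p) (hmaps : MapsTo atil (Ici 0) (Ici 0))
    (hinv : InvOn atil (a p α) (Ici 0) (Ici 0)) {b : ℝ} (hb : b < p / (p + 1)) :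
    ∃ C : ℝ, 0 < C ∧ ∀ t : ℝ, 0 ≤ t → b * (t * atil t) - C ≤ Atilde atil t := by
  obtain ⟨X, hX, hmono⟩ := exists_monotoneOn_Atilde_comp_a hp hmaps hinv hb
  have haX := a_nonneg p α hX.le
  have hsmall : ∀ x, 0 ≤ x → x ≤ X → b * (a p α x * x) ≤ |b| * (a p α X * X) := by
    intro x hx hxX
    have hle := (strictMonoOn_a_of_injOn hp hinv.1.injOn).monotoneOn hx hX.le hxX
    have hax := a_nonneg p α hx
    calc b * (a p α x * x) ≤ |b| * (a p α x * x) := by gcongr; exact le_abs_self b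
      _ ≤ |b| * (a p α X * X) := by gcongr
  refine ⟨|b| * (a p α X * X) + 1, by positivity, fun t ht => ?_⟩
  have hx : 0 ≤ atil t := hmaps ht
  have hat : a p α (atil t) = t := hinv.2 ht
  rcases le_total (atil t) X with h | h
  · have := hsmall _ hx h
    rw [hat] at this
    linarith [Atilde_nonneg hmaps ht]
  · have := hmono self_mem_Ici h h
    simp only [hat] at this
    linarith [hsmall X hX.le le_rfl, Atilde_nonneg hmaps haX]

end Inverse

/-- For p > 0, α ≤ p and 0 ≤ θ < p/(p+1), for every ε > 0 there is
C_ε > 0 with Ã(t) − θ·t·ã(t) ≥ (p/(p+1) − θ − ε)·t·ã(t) − C_ε for all t ≥ 0. -/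
theorem Atilde_theta_lower_bound (p α θ : ℝ) (hp : 0 < p) (hα : α ≤ p)
    (hθ0 : 0 ≤ θ) (hθ : θ < p / (p + 1))
    (atil : ℝ → ℝ) (hmaps : Set.MapsTo atil (Set.Ici 0) (Set.Ici 0))
    (hinv : Set.InvOn atil (a p α) (Set.Ici 0) (Set.Ici 0)) :
    ∀ ε : ℝ, 0 < ε → ∃ C : ℝ, 0 < C ∧ ∀ t : ℝ, 0 ≤ t →
      (p / (p + 1) - θ - ε) * (t * atil t) - C ≤ Atilde atil t - θ * (t * atil t) := by
  intro ε hε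
  obtain ⟨C, hC, h⟩ := exists_sub_le_Atilde hp hmaps hinv (b := p / (p + 1) - ε) (by linarith)
  exact ⟨C, hC, fun t ht => by linarith [h t ht]⟩
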